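/- arXiv:2312.12528 — 2 statements merged into one kernel-verified Lean document; each statement's English description precedes it below -/
import Mathlib

section
/- (Padding lemma) Let R be a reduced complete local one-dimensional k-algebra with normalization R̃, and let M be an R-lattice in K^d containing an R̃-lattice M̲. Then for any R̃-lattice Ñ of K^d, there exists g ∈ GL_d(K) with g(Ñ) = Ñ + M̲ such that g(x) − x ∈ M̲ for all x ∈ Ñ, and the map N ↦ g·N is a bijection from {R-lattices N ⊆ Ñ ∩ M with R̃N = Ñ} to {R-lattices L ⊆ (Ñ + M̲) ∩ M with R̃L = Ñ + M̲}. -/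
section Valuative

variable {A F V : Type*} [CommRing A] [Field F] [Algebra A F]

theorem exists_forall_eq_algebraMap_mul
    (hval : ∀ x : F, x ∈ (algebraMap A F).range ∨ x⁻¹ ∈ (algebraMap A F).range)
    {ι : Type*} (s : Finset ι) (hs : s.Nonempty) (f : ι → F) :
    ∃ i ∈ s, ∀ j ∈ s, ∃ a : A, f j = algebraMap A F a * f i := by
  induction hs using Finset.Nonempty.cons_induction with
  | singleton i => exact ⟨i, by simp, fun j hj => ⟨1, by simp_all⟩⟩
  | cons i s hi hs ih =>
    obtain ⟨j, hj, h⟩ := ih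
    have total : (∃ a : A, f i = algebraMap A F a * f j) ∨
        ∃ a : A, f j = algebraMap A F a * f i := by
      rcases eq_or_ne (f j) 0 with h0 | h0
      · exact .inr ⟨0, by simp [h0]⟩
      rcases eq_or_ne (f i) 0 with h1 | h1
      · exact .inl ⟨0, by simp [h1]⟩
      rcases hval (f i / f j) with ⟨a, ha⟩ | ⟨a, ha⟩
      · exact .inl ⟨a, by rw [ha]; field_simp⟩
      · exact .inr ⟨a, by rw [ha]; field_simp⟩
    rcases total with ⟨a, ha⟩ | ⟨a, ha⟩
    · refine ⟨j, by simp [hj], fun l hl => ?_⟩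
      rcases Finset.mem_cons.1 hl with rfl | hl
      · exact ⟨a, ha⟩
      · exact h l hl
    · refine ⟨i, by simp, fun l hl => ?_⟩
      rcases Finset.mem_cons.1 hl with rfl | hl
      · exact ⟨1, by simp⟩
      · obtain ⟨c, hc⟩ := h l hl
        exact ⟨c * a, by rw [hc, ha, map_mul, mul_assoc]⟩

variable [AddCommGroup V] [Module F V] [Module A V] [IsScalarTower A F V]

theorem Submodule.FG.exists_linearIndepOn_span_eq
    (hval : ∀ x : F, x ∈ (algebraMap A F).range ∨ x⁻¹ ∈ (algebraMap A F).range)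
    {N : Submodule A V} (hN : N.FG) :
    ∃ S : Finset V, Submodule.span A (S : Set V) = N ∧ LinearIndepOn F id (S : Set V) := by
  classical
  have hex : ∃ n : ℕ, ∃ S : Finset V, S.card = n ∧ Submodule.span A (S : Set V) = N := by
    obtain ⟨S, hS⟩ := hN
    exact ⟨_, S, rfl, hS⟩
  obtain ⟨S, hcard, hS⟩ := Nat.find_spec hex
  refine ⟨S, hS, ?_⟩
  rw [linearIndepOn_finset_iff]
  by_contra! hdep
  obtain ⟨f, hf, i, hi, hfi⟩ := hdep
  obtain ⟨j, hj, hmax⟩ := exists_forall_eq_algebraMap_mul hval S ⟨i, hi⟩ f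
  have hfj : f j ≠ 0 := by
    intro h0
    obtain ⟨a, ha⟩ := hmax i hi
    exact hfi (by rw [ha, h0, mul_zero])
  choose! a ha using hmax
  have hsum : ∑ v ∈ S, a v • v = 0 := by
    have : f j • ∑ v ∈ S, a v • v = 0 := by
      rw [← hf, Finset.smul_sum]
      refine Finset.sum_congr rfl fun v hv => ?_
      rw [ha v hv, id, mul_comm, mul_smul, algebraMap_smul]
    exact (smul_eq_zero.1 this).resolve_left hfj
  have hjmem : j ∈ Submodule.span A ((S.erase j : Finset V) : Set V) := by
    have haj : a j • j = j := by
      have h1 : algebraMap A F (a j) = 1 := by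
        have := ha j hj
        field_simp at this
        exact this.symm
      rw [← algebraMap_smul F, h1, one_smul]
    rw [← Finset.add_sum_erase S _ hj, haj] at hsum
    have hsum' : ∑ v ∈ S.erase j, a v • v ∈ Submodule.span A ((S.erase j : Finset V) : Set V) :=
      sum_mem fun v hv => Submodule.smul_mem _ _ (Submodule.subset_span (by exact_mod_cast hv))
    have := neg_mem hsum'
    rwa [← eq_neg_of_add_eq_zero_left hsum] at this
  have hspan : Submodule.span A ((S.erase j : Finset V) : Set V) = N := by
    rw [← hS]
    refine le_antisymm (Submodule.span_mono (by exact_mod_cast S.erase_subset j))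
      (Submodule.span_le.2 fun v hv => ?_)
    rcases eq_or_ne v j with rfl | hvj
    · exact hjmem
    · exact Submodule.subset_span (by exact_mod_cast Finset.mem_erase.2 ⟨hvj, by exact_mod_cast hv⟩)
  have := Nat.find_min' hex ⟨S.erase j, rfl, hspan⟩
  have := Finset.card_erase_lt_of_mem hj
  omega

theorem Submodule.FG.exists_basis_span_eq
    (hval : ∀ x : F, x ∈ (algebraMap A F).range ∨ x⁻¹ ∈ (algebraMap A F).range)
    {N : Submodule A V} (hN : N.FG) (hspan : Submodule.span F (N : Set V) = ⊤) :
    ∃ (S : Finset V) (b : Module.Basis S F V), Submodule.span A (Set.range b) = N := by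
  obtain ⟨S, hS, hli⟩ := hN.exists_linearIndepOn_span_eq hval
  have hli' : LinearIndependent F (fun v : S => (v : V)) := hli
  refine ⟨S, .mk hli' ?_, ?_⟩
  · rw [← hspan, Submodule.span_le, ← hS]
    refine (Submodule.span_subset_span A F (S : Set V)).trans ?_
    simp
  · have hrange : Set.range (fun v : S => (v : V)) = S := by simp
    rw [Module.Basis.coe_mk, hrange]
    exact hS

/-- The valuation of a nonzero coordinate of an element of `M` that is largest among all
coordinates of elements of `M` splits off a common direct summand of `N` and `M`. -/
theorem Submodule.FG.exists_common_summand
    (hval : ∀ x : F, x ∈ (algebraMap A F).range ∨ x⁻¹ ∈ (algebraMap A F).range)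
    {N M : Submodule A V} (hN : N.FG) (hspan : Submodule.span F (N : Set V) = ⊤)
    (hM : M.FG) (hM0 : M ≠ ⊥) :
    ∃ (φ : V →ₗ[F] F) (e : V) (c : F), c ≠ 0 ∧ φ e = 1 ∧ e ∈ N ∧ c • e ∈ M ∧
      (∀ x ∈ N, ∃ a : A, φ x = algebraMap A F a) ∧
      ∀ x ∈ M, ∃ a : A, φ x = algebraMap A F a * c := by
  obtain ⟨S, b, hb⟩ := hN.exists_basis_span_eq hval hspan
  obtain ⟨T, hT⟩ := hM
  have hT0 : ∃ m ∈ T, m ≠ 0 := by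
    by_contra! h
    exact hM0 (by rw [← hT, Submodule.span_eq_bot]; exact h)
  obtain ⟨m, hm, hm0⟩ := hT0
  obtain ⟨i, hi⟩ : ∃ i, b.repr m i ≠ 0 := by
    by_contra! h
    exact hm0 (b.repr.map_eq_zero_iff.1 (Finsupp.ext h))
  obtain ⟨⟨m', j⟩, hmem, hmax⟩ := exists_forall_eq_algebraMap_mul hval (T ×ˢ Finset.univ)
    ⟨(m, i), by simp [hm]⟩ (fun q => b.repr q.1 q.2)
  have hm' : m' ∈ T := by simpa using hmem
  have hmax' : ∀ x ∈ T, ∀ l, ∃ a : A, b.repr x l = algebraMap A F a * b.repr m' j :=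
    fun x hx l => hmax (x, l) (by simp [hx])
  have hc : b.repr m' j ≠ 0 := by
    intro h0
    obtain ⟨a, ha⟩ := hmax' m hm i
    exact hi (by rw [ha, h0, mul_zero])
  refine ⟨b.coord j, (b.repr m' j)⁻¹ • m', b.repr m' j, hc, by simp [hc], ?_, ?_, ?_, ?_⟩
  · choose a ha using hmax' m' hm'
    have : (b.repr m' j)⁻¹ • m' = ∑ l, a l • b l := by
      refine b.repr.injective ?_
      rw [← b.sum_repr ((b.repr m' j)⁻¹ • m')]
      congr 1
      refine Finset.sum_congr rfl fun l _ => ?_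
      rw [map_smul, Finsupp.smul_apply, ha l, smul_eq_mul, mul_left_comm, inv_mul_cancel₀ hc,
        mul_one, algebraMap_smul]
    rw [this, ← hb]
    exact sum_mem fun l _ => Submodule.smul_mem _ _ (Submodule.subset_span ⟨l, rfl⟩)
  · rw [smul_inv_smul₀ hc, ← hT]
    exact Submodule.subset_span hm'
  · intro x hx
    rw [← hb] at hx
    induction hx using Submodule.span_induction with
    | mem x hx =>
      obtain ⟨l, rfl⟩ := hx
      by_cases h : l = j
      · exact ⟨1, by simp [h]⟩
      · exact ⟨0, by simp [h]⟩
    | zero => exact ⟨0, by simp⟩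
    | add x y _ _ hx hy =>
      obtain ⟨a, ha⟩ := hx
      obtain ⟨a', ha'⟩ := hy
      exact ⟨a + a', by simp only [map_add, ha, ha']⟩
    | smul r x _ hx =>
      obtain ⟨a, ha⟩ := hx
      exact ⟨r * a, by rw [← algebraMap_smul F r x, map_smul, ha, map_mul, smul_eq_mul]⟩
  · intro x hx
    rw [← hT] at hx
    induction hx using Submodule.span_induction with
    | mem x hx => exact hmax' x hx j
    | zero => exact ⟨0, by simp⟩
    | add x y _ _ hx hy =>
      obtain ⟨a, ha⟩ := hx
      obtain ⟨a', ha'⟩ := hy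
      exact ⟨a + a', by simp only [map_add, ha, ha', add_mul]⟩
    | smul r x _ hx =>
      obtain ⟨a, ha⟩ := hx
      exact ⟨r * a, by rw [← algebraMap_smul F r x, map_smul, ha, map_mul, smul_eq_mul, mul_assoc]⟩

theorem exists_linearEquiv_sub_mem_of_valuative
    (hval : ∀ x : F, x ∈ (algebraMap A F).range ∨ x⁻¹ ∈ (algebraMap A F).range)
    (n : ℕ) : ∀ {V : Type*} [AddCommGroup V] [Module F V] [Module A V] [IsScalarTower A F V]
    [FiniteDimensional F V] (_ : Module.finrank F V = n)
    (N M : Submodule A V) (_ : N.FG) (_ : Submodule.span F (N : Set V) = ⊤) (_ : M.FG),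
    ∃ g : V ≃ₗ[F] V, (∀ x ∈ N, g x - x ∈ M) ∧ ∀ y ∈ N ⊔ M, ∃ x ∈ N, g x = y := by
  induction n with
  | zero =>
    intro V _ _ _ _ _ hV N M _ _ _
    have := Module.finrank_zero_iff.1 hV
    exact ⟨.refl F V, fun x _ => by simp, fun y _ => ⟨0, zero_mem _, Subsingleton.elim _ _⟩⟩
  | succ n ih =>
    intro V _ _ _ _ _ hV N M hN hspan hM
    by_cases hM0 : M = ⊥
    · exact ⟨.refl F V, fun x _ => by simp, fun y hy => ⟨y, by simpa [hM0] using hy, rfl⟩⟩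
    obtain ⟨φ, e, c, hc, he, heN, heM, hφN, hφM⟩ := hN.exists_common_summand hval hspan hM hM0
    let p : V →ₗ[F] LinearMap.ker φ :=
      (LinearMap.id - φ.smulRight e).codRestrict _ fun x => by simp [he]
    have hp (x : V) : (p x : V) = x - φ x • e := rfl
    have hpW (w : LinearMap.ker φ) : p w = w := by
      ext
      rw [hp, w.2, zero_smul, sub_zero]
    have hpe : p e = 0 := by
      ext
      simp [hp, he]
    let q : V →ₗ[A] LinearMap.ker φ := p.restrictScalars A
    have hNp (x : V) (hx : x ∈ N) : (p x : V) ∈ N := by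
      obtain ⟨a, ha⟩ := hφN x hx
      rw [hp, ha, algebraMap_smul]
      exact sub_mem hx (N.smul_mem _ heN)
    have hMp (x : V) (hx : x ∈ M) : (p x : V) ∈ M := by
      obtain ⟨a, ha⟩ := hφM x hx
      rw [hp, ha, mul_smul, algebraMap_smul]
      exact sub_mem hx (M.smul_mem _ heM)
    have hW : Module.finrank F (LinearMap.ker φ) = n := by
      have h1 := φ.finrank_range_add_finrank_ker
      have h2 : LinearMap.range φ = ⊤ := LinearMap.range_eq_top.2 fun t => ⟨t • e, by simp [he]⟩
      rw [h2, finrank_top, Module.finrank_self, hV] at h1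
      omega
    have hspanW : Submodule.span F (SetLike.coe (N.map q)) = ⊤ := by
      have : SetLike.coe (N.map q) = p '' N := rfl
      rw [this, Submodule.span_image, hspan, Submodule.map_top, LinearMap.range_eq_top]
      exact fun w => ⟨w, hpW w⟩
    obtain ⟨g, hg, hg'⟩ := ih hW (N.map q) (M.map q) (hN.map q) hspanW (hM.map q)
    obtain ⟨t, ht0, htM, htN, htM'⟩ : ∃ t : F, t ≠ 0 ∧ (t - 1) • e ∈ M ∧
        (∃ a : A, algebraMap A F a = t⁻¹) ∧ ∃ a : A, algebraMap A F a = t⁻¹ * c := by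
      rcases hval c with ⟨a, ha⟩ | ⟨a, ha⟩
      · exact ⟨1, one_ne_zero, by simp, ⟨1, by simp⟩, ⟨a, by simp [ha]⟩⟩
      · refine ⟨c, hc, ?_, ⟨a, ha⟩, ⟨1, by simp [hc]⟩⟩
        have : e = a • c • e := by rw [← algebraMap_smul F a, ha, inv_smul_smul₀ hc]
        rw [sub_smul, one_smul]
        refine sub_mem heM ?_
        rw [this]
        exact M.smul_mem _ heM
    let G : V →ₗ[F] V :=
      (t • φ).smulRight e + (LinearMap.ker φ).subtype ∘ₗ (g : LinearMap.ker φ →ₗ[F] _) ∘ₗ p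
    have hG (x : V) : G x = (t * φ x) • e + (g (p x) : V) := rfl
    have hφG (x : V) : φ (G x) = t * φ x := by
      rw [hG, map_add, map_smul, he, (g (p x)).2]
      simp
    have hpG (x : V) : p (G x) = g (p x) := by
      rw [hG, map_add, map_smul, hpe, hpW]
      simp
    have hinj : Function.Injective G := by
      rw [injective_iff_map_eq_zero]
      intro x hx
      have h1 : φ x = 0 := by
        have := hφG x
        rw [hx, map_zero] at this
        exact (mul_eq_zero.1 this.symm).resolve_left ht0
      have h2 : p x = 0 := by
        have := hpG x
        rw [hx, map_zero] at this
        exact g.map_eq_zero_iff.1 this.symm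
      have h3 := hp x
      rw [h1, h2, zero_smul, sub_zero] at h3
      exact h3.symm
    refine ⟨LinearEquiv.ofInjectiveEndo G hinj, fun x hx => ?_, fun y hy => ?_⟩
    · rw [LinearEquiv.coe_ofInjectiveEndo]
      obtain ⟨a, ha⟩ := hφN x hx
      obtain ⟨m, hm, hmx⟩ := hg (p x) ⟨x, hx, rfl⟩
      have hmx' : (p m : V) = g (p x) - p x := congrArg Subtype.val hmx
      have : G x - x = a • (t - 1) • e + p m := by
        rw [hmx', hG, hp, ← algebraMap_smul F a, ← ha]
        module
      rw [this]
      exact add_mem (M.smul_mem _ htM) (hMp m hm)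
    · obtain ⟨z, hz, hzy⟩ := hg' (p y) (by
        rw [← Submodule.map_sup]
        exact ⟨y, hy, rfl⟩)
      obtain ⟨z', hz', rfl⟩ := hz
      obtain ⟨b, hb⟩ : ∃ b : A, algebraMap A F b = t⁻¹ * φ y := by
        obtain ⟨u, hu, v, hv, rfl⟩ := Submodule.mem_sup.1 hy
        obtain ⟨a, ha⟩ := hφN u hu
        obtain ⟨a', ha'⟩ := hφM v hv
        obtain ⟨r, hr⟩ := htN
        obtain ⟨r', hr'⟩ := htM'
        refine ⟨a * r + a' * r', ?_⟩
        rw [map_add, map_add, map_mul, map_mul, ha, ha', hr, hr']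
        ring
      refine ⟨b • e + p z', add_mem (N.smul_mem _ heN) (hNp z' hz'), ?_⟩
      have hpz : p (b • e + p z') = p z' := by
        rw [map_add, hpW, ← algebraMap_smul F b, map_smul, hpe, smul_zero, zero_add]
      have hφz : φ (b • e + p z') = t⁻¹ * φ y := by
        rw [map_add, (p z').2, ← algebraMap_smul F b, map_smul, he, hb]
        simp
      rw [LinearEquiv.coe_ofInjectiveEndo, hG, hpz, hφz, mul_inv_cancel_left₀ ht0]
      have : g (p z') = p y := hzy
      rw [this, hp]
      module

end Valuative

section Integrality
open Polynomial

variable {R : Type*} [CommRing R]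

theorem exists_aeval_eq_zero_map_residue_ne_zero [IsLocalRing R] [IsNoetherianRing R]
    {K : Type*} [CommRing K] [Algebra R K] [IsFractionRing R K] (hdim : ringKrullDim R = 1)
    (x : K) : ∃ f : R[X], aeval x f = 0 ∧ f.map (IsLocalRing.residue R) ≠ 0 := by
  by_contra! hJ
  obtain ⟨⟨a, b⟩, hab⟩ := IsLocalization.surj (nonZeroDivisors R) x
  set J : Ideal R[X] := RingHom.ker (aeval x : R[X] →ₐ[R] K)
  set f : R[X] := C (b : R) * X - C a
  have hfJ : f ∈ J := by
    simp only [J, RingHom.mem_ker, f, map_sub, map_mul, aeval_C, aeval_X]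
    rw [mul_comm, sub_eq_zero]
    exact hab
  have hf0 : f.map (IsLocalRing.residue R) = 0 := hJ f hfJ
  have hb : (b : R) ∈ IsLocalRing.maximalIdeal R := by
    have := congrArg (coeff · 1) hf0
    simpa [f, coeff_C] using this
  have hfreg : f ∈ nonZeroDivisors R[X] := by
    rw [Polynomial.mem_nonZeroDivisors_iff]
    intro r hr
    have := congrArg (coeff · 1) hr
    refine (mem_nonZeroDivisors_iff.1 b.2).2 r ?_
    simpa [f, coeff_C] using this
  have h1 : ringKrullDim (R[X] ⧸ J) + 1 ≤ ringKrullDim R[X] :=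
    ringKrullDim_succ_le_of_surjective (Ideal.Quotient.mk J) Ideal.Quotient.mk_surjective hfreg
      (Ideal.Quotient.eq_zero_iff_mem.2 hfJ)
  have hbreg : (Ideal.Quotient.mk J (C (b : R))) ∈ nonZeroDivisors (R[X] ⧸ J) := by
    rw [mem_nonZeroDivisors_iff_right]
    intro y hy
    obtain ⟨p, rfl⟩ := Ideal.Quotient.mk_surjective y
    rw [← map_mul, Ideal.Quotient.eq_zero_iff_mem, RingHom.mem_ker, map_mul, aeval_C] at hy
    rw [Ideal.Quotient.eq_zero_iff_mem, RingHom.mem_ker]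
    exact ((IsLocalization.map_units K b).mul_left_eq_zero).1 hy
  have hJ' : ∀ g ∈ J, mapRingHom (IsLocalRing.residue R) g = 0 := hJ
  have h2 : ringKrullDim (IsLocalRing.ResidueField R)[X] + 1 ≤ ringKrullDim (R[X] ⧸ J) := by
    refine ringKrullDim_succ_le_of_surjective
      (Ideal.Quotient.lift J (mapRingHom (IsLocalRing.residue R)) hJ')
      (Ideal.Quotient.lift_surjective_of_surjective _ _ <|
        map_surjective _ IsLocalRing.residue_surjective) hbreg ?_
    rw [Ideal.Quotient.lift_mk, coe_mapRingHom, map_C, (IsLocalRing.residue_eq_zero_iff _).2 hb,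
      C_0]
  rw [Polynomial.ringKrullDim_of_isNoetherianRing, ringKrullDim_eq_zero_of_field] at h2
  rw [Polynomial.ringKrullDim_of_isNoetherianRing, hdim] at h1
  have h3 : (3 : WithBot ℕ∞) ≤ 2 := by
    calc (3 : WithBot ℕ∞) = 0 + 1 + 1 + 1 := by norm_num
      _ ≤ _ := add_le_add_left h2 1
      _ ≤ 1 + 1 := h1
      _ = 2 := by norm_num
  exact absurd h3 (by decide)

theorem exists_eq_mul_monic_isUnit_coeff_zero [IsLocalRing R]
    [IsAdicComplete (IsLocalRing.maximalIdeal R) R]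
    (f : R[X]) (hf : f.map (IsLocalRing.residue R) ≠ 0) :
    ∃ p q : R[X], f = p * q ∧ p.Monic ∧ IsUnit (q.coeff 0) := by
  have hf' : (f : PowerSeries R).map (IsLocalRing.residue R) ≠ 0 := by
    rw [← Polynomial.polynomial_map_coe]
    exact_mod_cast hf
  obtain ⟨p, h, H⟩ := PowerSeries.exists_isWeierstrassFactorization hf'
  have hp := H.isDistinguishedAt.monic
  have hdeg : (p.natDegree : ℕ∞) = _ := H.isDistinguishedAt.coe_natDegree_eq_order_map p 1
    (by rw [map_one, ← Ideal.ne_top_iff_one]; exact Ideal.IsPrime.ne_top') (by simp)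
  have hlt : (f %ₘ p).degree < ((p : PowerSeries R).map
      (Ideal.Quotient.mk (IsLocalRing.maximalIdeal R))).order.toNat := by
    rw [← hdeg, ENat.toNat_natCast, ← degree_eq_natDegree hp.ne_zero]
    exact degree_modByMonic_lt f hp
  have heq : (p : PowerSeries R) * (h - (f /ₘ p : R[X])) = (f %ₘ p : R[X]) := by
    rw [mul_sub, ← H.eq_mul, ← Polynomial.coe_mul, ← Polynomial.coe_sub]
    congr 1
    rw [sub_eq_iff_eq_add, modByMonic_add_div]
  obtain ⟨h1, h2⟩ := H.isDistinguishedAt.isWeierstrassDivisorAt'.eq_zero_of_mul_eq hlt heq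
  refine ⟨p, f /ₘ p, ?_, hp, ?_⟩
  · conv_lhs => rw [← modByMonic_add_div f p, h2, zero_add]
  · have := PowerSeries.isUnit_constantCoeff _ H.isUnit
    rwa [sub_eq_zero.1 h1, Polynomial.constantCoeff_coe] at this

theorem isIntegral_of_isUnit_leadingCoeff {S : Type*} [CommRing S] [Algebra R S] {x : S}
    {p : R[X]} (hp : IsUnit p.leadingCoeff) (hx : aeval x p = 0) : IsIntegral R x := by
  obtain ⟨u, hu⟩ := hp
  refine ⟨C (↑u⁻¹ : R) * p, monic_C_mul_of_mul_leadingCoeff_eq_one (by rw [← hu]; simp), ?_⟩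
  rw [← aeval_def, map_mul, hx, mul_zero]

theorem isIntegral_or_isIntegral_inv [IsLocalRing R]
    [IsAdicComplete (IsLocalRing.maximalIdeal R) R]
    {F : Type*} [Field F] [Algebra R F] (x : F) (f : R[X]) (hx : aeval x f = 0)
    (hf : f.map (IsLocalRing.residue R) ≠ 0) : IsIntegral R x ∨ IsIntegral R x⁻¹ := by
  obtain ⟨p, q, rfl, hp, hq⟩ := exists_eq_mul_monic_isUnit_coeff_zero f hf
  rw [map_mul, mul_eq_zero] at hx
  refine hx.imp (fun h => ⟨p, hp, h⟩) fun h => ?_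
  rcases eq_or_ne x 0 with rfl | hx0
  · simpa using isIntegral_zero
  refine isIntegral_of_isUnit_leadingCoeff (p := q.reverse) ?_ ?_
  · rwa [reverse_leadingCoeff, trailingCoeff,
      natTrailingDegree_eq_zero.2 (.inr hq.ne_zero)]
  · let := invertibleOfNonzero hx0
    rw [aeval_def, ← invOf_eq_inv, eval₂_reverse_eq_zero_iff]
    exact h

end Integrality

section TotalFractions

variable {K : Type*} [CommRing K]

theorem IsFractionRing.isArtinianRing_of_isReduced [IsNoetherianRing K] [IsReduced K]
    [IsFractionRing K K] : IsArtinianRing K := by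
  rw [isArtinianRing_iff_krullDimLE_zero]
  refine .mk₀ fun q hq => ?_
  obtain ⟨m, hm, hqm⟩ := q.exists_le_maximal hq.ne_top
  obtain ⟨-, x, hx⟩ := (isAssociatedPrime_iff (I := m) (M := K)).1
    (hm.mem_associatedPrimes_of_isFractionRing)
  have hmul (y : K) (hy : y ∈ m) : y * x = 0 := by
    rw [hx, Submodule.mem_colon_singleton] at hy
    simpa using hy
  have hxm : x ∉ m := by
    intro h
    have hx0 : x = 0 := by
      have := hmul x h
      exact IsReduced.eq_zero x ⟨2, by rw [pow_two, this]⟩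
    refine hm.ne_top ?_
    rw [hx, hx0]
    simp
  have : m ≤ q := fun y hy =>
    (hq.mem_or_mem (by rw [hmul y hy]; exact zero_mem _)).resolve_right fun h => hxm (hqm h)
  rwa [le_antisymm hqm this]

/-- An integral element of a residue field of a reduced Artinian ring lifts to an integral
element. -/
theorem IsIntegral.exists_isIntegral_mk_eq {R : Type*} [CommRing R] [Algebra R K]
    [IsArtinianRing K] [IsReduced K] (m : MaximalSpectrum K) {x : K ⧸ m.asIdeal}
    (hx : IsIntegral R x) : ∃ y : K, IsIntegral R y ∧ Ideal.Quotient.mk m.asIdeal y = x := by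
  classical
  set v : ∀ n : MaximalSpectrum K, K ⧸ n.asIdeal := Pi.single m x with hv
  obtain ⟨y, hy⟩ := (IsArtinianRing.equivPi K).surjective v
  have hy' (n : MaximalSpectrum K) : Ideal.Quotient.mk n.asIdeal y = v n := congrFun hy n
  obtain ⟨p, hp, hpx⟩ := hx
  refine ⟨y, ⟨Polynomial.X * p, Polynomial.monic_X.mul hp, ?_⟩, by rw [hy', hv, Pi.single_eq_same]⟩
  refine (IsArtinianRing.equivPi K).injective (funext fun n => ?_)
  rw [map_zero, Pi.zero_apply, IsArtinianRing.equivPi_apply]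
  change Ideal.Quotient.mk n.asIdeal _ = 0
  rw [Polynomial.hom_eval₂, Polynomial.eval₂_mul, Polynomial.eval₂_X, hy']
  rcases eq_or_ne n m with rfl | hnm
  · rw [hv, Pi.single_eq_same]
    exact mul_eq_zero_of_right _ hpx
  · rw [hv, Pi.single_eq_of_ne hnm, zero_mul]

end TotalFractions

section Artinian

variable {A K : Type*} [CommRing A] [CommRing K] [IsArtinianRing K] [IsReduced K] [Algebra A K]

/-- The coordinatewise decomposition of a finite free module over a reduced Artinian ring. -/
noncomputable def IsArtinianRing.piEquivPi (K ι : Type*) [CommRing K] [IsArtinianRing K]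
    [IsReduced K] : (ι → K) ≃ₗ[K] ∀ m : MaximalSpectrum K, ι → K ⧸ m.asIdeal :=
  .ofBijective (LinearMap.pi fun m => (Algebra.linearMap K (K ⧸ m.asIdeal)).compLeft ι) <| by
    constructor
    · intro x y hxy
      ext i
      refine (IsArtinianRing.equivPi K).injective (funext fun m => ?_)
      exact congrFun (congrFun hxy m) i
    · intro y
      choose x hx using fun i => (IsArtinianRing.equivPi K).surjective fun m => y m i
      exact ⟨x, funext fun m => funext fun i => congrFun (hx i) m⟩

theorem exists_linearEquiv_sub_mem_of_isArtinianRing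
    (hidem : ∀ m : MaximalSpectrum K, ∃ a : A, algebraMap A (K ⧸ m.asIdeal) a = 1 ∧
      ∀ n : MaximalSpectrum K, n ≠ m → algebraMap A (K ⧸ n.asIdeal) a = 0)
    (hval : ∀ (m : MaximalSpectrum K) (x y : K ⧸ m.asIdeal), x * y = 1 →
      x ∈ (algebraMap A (K ⧸ m.asIdeal)).range ∨ y ∈ (algebraMap A (K ⧸ m.asIdeal)).range)
    {ι : Type*} [Finite ι] {N M : Submodule A (ι → K)} (hN : N.FG)
    (hspan : Submodule.span K (N : Set (ι → K)) = ⊤) (hM : M.FG) :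
    ∃ g : (ι → K) ≃ₗ[K] (ι → K), (∀ x ∈ N, g x - x ∈ M) ∧ ∀ y ∈ N ⊔ M, ∃ x ∈ N, g x = y := by
  classical
  have := Fintype.ofFinite (MaximalSpectrum K)
  let Φ := IsArtinianRing.piEquivPi K ι
  let π (m : MaximalSpectrum K) : (ι → K) →ₗ[K] (ι → K ⧸ m.asIdeal) :=
    LinearMap.proj m ∘ₗ Φ.toLinearMap
  let πA (m : MaximalSpectrum K) : (ι → K) →ₗ[A] (ι → K ⧸ m.asIdeal) := (π m).restrictScalars A
  have hπ (m : MaximalSpectrum K) : Function.Surjective (π m) :=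
    (LinearMap.proj_surjective (R := K) (φ := fun m : MaximalSpectrum K => ι → K ⧸ m.asIdeal)
      m).comp Φ.surjective
  choose a ha ha' using hidem
  have hmem (L : Submodule A (ι → K)) (x : ι → K) (hx : ∀ m, π m x ∈ L.map (πA m)) : x ∈ L := by
    choose y hy hyx using hx
    have : x = ∑ m, a m • y m := by
      refine Φ.injective (funext fun n => ?_)
      change π n x = πA n _
      rw [map_sum, Finset.sum_eq_single n]
      · rw [map_smul, ← algebraMap_smul (K ⧸ n.asIdeal), ha n, one_smul, hyx]
      · intro m _ hmn
        rw [map_smul, ← algebraMap_smul (K ⧸ n.asIdeal), ha' m n hmn.symm, zero_smul]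
      · simp
    rw [this]
    exact sum_mem fun m _ => L.smul_mem _ (hy m)
  have hloc (m : MaximalSpectrum K) :
      ∃ g : (ι → K ⧸ m.asIdeal) ≃ₗ[K ⧸ m.asIdeal] (ι → K ⧸ m.asIdeal),
      (∀ x ∈ N.map (πA m), g x - x ∈ M.map (πA m)) ∧
      ∀ y ∈ N.map (πA m) ⊔ M.map (πA m), ∃ x ∈ N.map (πA m), g x = y := by
    let := Ideal.Quotient.field m.asIdeal
    refine exists_linearEquiv_sub_mem_of_valuative (A := A) (fun x => ?_) _ rfl _ _ (hN.map _) ?_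
      (hM.map _)
    · rcases eq_or_ne x 0 with rfl | hx
      · exact .inl (zero_mem _)
      · exact hval m x x⁻¹ (mul_inv_cancel₀ hx)
    · rw [eq_top_iff]
      rintro v -
      obtain ⟨w, rfl⟩ := hπ m v
      have hw : w ∈ Submodule.span K (N : Set (ι → K)) := hspan ▸ Submodule.mem_top
      have : π m w ∈ Submodule.span K (π m '' N) := by
        rw [Submodule.span_image]
        exact ⟨w, hw, rfl⟩
      exact Submodule.span_subset_span K (K ⧸ m.asIdeal) _ this
  choose g hg hg' using hloc
  let G : (ι → K) ≃ₗ[K] (ι → K) :=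
    Φ ≪≫ₗ LinearEquiv.piCongrRight (fun m => (g m).restrictScalars K) ≪≫ₗ Φ.symm
  have hG (m : MaximalSpectrum K) (x : ι → K) : π m (G x) = g m (π m x) := by
    change Φ (Φ.symm _) m = _
    rw [Φ.apply_symm_apply]
    rfl
  refine ⟨G, fun x hx => hmem M _ fun m => ?_, fun y hy => ⟨G.symm y, hmem N _ fun m => ?_, by simp⟩⟩
  · rw [map_sub, hG]
    exact hg m _ ⟨x, hx, rfl⟩
  · obtain ⟨z, hz, hzy⟩ := hg' m (π m y) (by rw [← Submodule.map_sup]; exact ⟨y, hy, rfl⟩)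
    have := hG m (G.symm y)
    rw [G.apply_symm_apply, ← hzy] at this
    rwa [← (g m).injective this]

end Artinian

theorem exists_linearEquiv_sub_mem_integralClosure {R K : Type*} [CommRing R] [IsLocalRing R]
    [IsNoetherianRing R] [IsReduced R] [IsAdicComplete (IsLocalRing.maximalIdeal R) R]
    (hdim : ringKrullDim R = 1) [CommRing K] [Algebra R K] [IsFractionRing R K]
    {ι : Type*} [Finite ι] {N M : Submodule (integralClosure R K) (ι → K)} (hN : N.FG)
    (hspan : Submodule.span K (N : Set (ι → K)) = ⊤) (hM : M.FG) :
    ∃ g : (ι → K) ≃ₗ[K] (ι → K), (∀ x ∈ N, g x - x ∈ M) ∧ ∀ y ∈ N ⊔ M, ∃ x ∈ N, g x = y := by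
  classical
  have : IsNoetherianRing K :=
    IsLocalization.isNoetherianRing (nonZeroDivisors R) K inferInstance
  have : IsReduced K := by
    refine ⟨fun x ⟨n, hn⟩ => ?_⟩
    obtain ⟨⟨a, s⟩, hs⟩ := IsLocalization.surj (nonZeroDivisors R) x
    have ha : a = 0 := by
      refine IsReduced.eq_zero a ⟨n, IsFractionRing.injective R K ?_⟩
      rw [map_pow, ← hs, mul_pow, hn, zero_mul, map_zero]
    rw [ha, map_zero] at hs
    exact (IsLocalization.map_units K s).mul_left_eq_zero.1 hs
  have : IsFractionRing K K := IsFractionRing.idem R K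
  have : IsArtinianRing K := IsFractionRing.isArtinianRing_of_isReduced
  have hrange (m : MaximalSpectrum K) (x : K ⧸ m.asIdeal) (hx : IsIntegral R x) :
      x ∈ (algebraMap (integralClosure R K) (K ⧸ m.asIdeal)).range := by
    obtain ⟨y, hy, rfl⟩ := hx.exists_isIntegral_mk_eq m
    exact ⟨⟨y, hy⟩, rfl⟩
  refine exists_linearEquiv_sub_mem_of_isArtinianRing (fun m => ?_) (fun m x y hxy => ?_) hN hspan hM
  · set v : ∀ n : MaximalSpectrum K, K ⧸ n.asIdeal := fun n => if n = m then 1 else 0 with hv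
    obtain ⟨e, he⟩ := (IsArtinianRing.equivPi K).surjective v
    have hee : e * e = e := by
      refine (IsArtinianRing.equivPi K).injective (funext fun n => ?_)
      rw [map_mul, he, Pi.mul_apply, hv]
      dsimp only
      split_ifs <;> simp
    have hint : IsIntegral R e :=
      ⟨.X ^ 2 - .X, by monicity!, by simp [pow_two, hee]⟩
    exact ⟨⟨e, hint⟩, (congrFun he m).trans (by simp [hv]),
      fun n hn => (congrFun he n).trans (by simp [hv, hn])⟩
  · let := Ideal.Quotient.field m.asIdeal
    obtain ⟨z, rfl⟩ := Ideal.Quotient.mk_surjective x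
    obtain ⟨f, hf, hf0⟩ := exists_aeval_eq_zero_map_residue_ne_zero hdim z
    have hfz : Polynomial.aeval (Ideal.Quotient.mk m.asIdeal z) f = 0 := by
      have := congrArg (Ideal.Quotient.mkₐ R m.asIdeal) hf
      rwa [← Polynomial.aeval_algHom_apply, map_zero] at this
    rw [eq_inv_of_mul_eq_one_right hxy]
    exact (isIntegral_or_isIntegral_inv _ f hfz hf0).imp (hrange m _) (hrange m _)

/-- Padding lemma.  Let `R` be a reduced complete local
one-dimensional `k`-algebra with total fraction ring `K` and normalization
`R̃ = integralClosure R K`, and let `M` be an `R`-lattice in `K^d` containing an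
`R̃`-lattice `M̲`.  Then for any `R̃`-lattice `Ñ` there exists `g ∈ GL_d(K)` with
`g(Ñ) = Ñ + M̲`, with `g x - x ∈ M̲` for all `x ∈ Ñ`, such that `N ↦ g·N` is a
bijection from `E_R(Ñ; M) = {R`-lattices `N ⊆ Ñ ∩ M : R̃N = Ñ}` onto
`E_R(Ñ + M̲; M)`. -/
theorem statement4 (k : Type*) [Field k] (R : Type*) [CommRing R] [Algebra k R]
    [IsLocalRing R] [IsNoetherianRing R] [IsReduced R]
    (hdim : ringKrullDim R = 1)
    (hcomplete : IsAdicComplete (IsLocalRing.maximalIdeal R) R)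
    (K : Type*) [CommRing K] [Algebra R K] [IsFractionRing R K]
    (d : ℕ)
    -- the R-lattice M
    (M : Submodule R (Fin d → K)) (hMFG : M.FG)
    (hMspan : Submodule.span K (M : Set (Fin d → K)) = ⊤)
    -- the R̃-lattice M̲ contained in M
    (Munder : Submodule (integralClosure R K) (Fin d → K)) (hMuFG : Munder.FG)
    (hMuspan : Submodule.span K (Munder : Set (Fin d → K)) = ⊤)
    (hMuM : (Munder : Set (Fin d → K)) ⊆ (M : Set (Fin d → K)))
    -- the R̃-lattice Ñ
    (N' : Submodule (integralClosure R K) (Fin d → K)) (hN'FG : N'.FG)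
    (hN'span : Submodule.span K (N' : Set (Fin d → K)) = ⊤) :
    ∃ g : (Fin d → K) ≃ₗ[K] (Fin d → K),
      (∀ x ∈ N', g x - x ∈ Munder) ∧
      ((⇑g) '' (N' : Set (Fin d → K)) = ((N' ⊔ Munder : Submodule (integralClosure R K) (Fin d → K)) : Set (Fin d → K))) ∧
      Set.BijOn
        (fun N : Submodule R (Fin d → K) =>
          N.map ((g : (Fin d → K) →ₗ[K] (Fin d → K)).restrictScalars R))
        {N : Submodule R (Fin d → K) | N.FG ∧
          Submodule.span K (N : Set (Fin d → K)) = ⊤ ∧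
          (N : Set (Fin d → K)) ⊆ (N' : Set (Fin d → K)) ∧
          (N : Set (Fin d → K)) ⊆ (M : Set (Fin d → K)) ∧
          Submodule.span (integralClosure R K) (N : Set (Fin d → K)) = N'}
        {L : Submodule R (Fin d → K) | L.FG ∧
          Submodule.span K (L : Set (Fin d → K)) = ⊤ ∧
          (L : Set (Fin d → K)) ⊆ ((N' ⊔ Munder : Submodule (integralClosure R K) (Fin d → K)) : Set (Fin d → K)) ∧
          (L : Set (Fin d → K)) ⊆ (M : Set (Fin d → K)) ∧
          Submodule.span (integralClosure R K) (L : Set (Fin d → K)) = N' ⊔ Munder} := by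
  obtain ⟨g, hg, hg'⟩ := exists_linearEquiv_sub_mem_integralClosure hdim hN'FG hN'span hMuFG
  have himage : (⇑g) '' (N' : Set (Fin d → K)) = (N' ⊔ Munder : Submodule _ _) := by
    refine Set.Subset.antisymm ?_ fun y hy => hg' y hy
    rintro _ ⟨x, hx, rfl⟩
    rw [← add_sub_cancel x (g x)]
    exact Submodule.add_mem_sup hx (hg x hx)
  let gA : (Fin d → K) →ₗ[integralClosure R K] (Fin d → K) := g.toLinearMap.restrictScalars _
  have hgA : N'.map gA = N' ⊔ Munder := SetLike.coe_injective himage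
  have hmapM (x : Fin d → K) (hx : x ∈ N') : g x ∈ M ↔ x ∈ M := by
    have h := hMuM (hg x hx)
    rw [← sub_add_cancel (g x) x]
    exact M.add_mem_iff_right h
  have hspanA (s : Set (Fin d → K)) : Submodule.span (integralClosure R K) (g '' s) =
      (Submodule.span (integralClosure R K) s).map gA := Submodule.span_image gA
  have hspanK (s : Set (Fin d → K)) : Submodule.span K (g '' s) =
      (Submodule.span K s).map g.toLinearMap := Submodule.span_image g.toLinearMap
  refine ⟨g, hg, himage, ?_, ?_, ?_⟩
  · rintro N ⟨hNFG, hNspan, hNN', hNM, hNA⟩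
    refine ⟨hNFG.map _, ?_, ?_, ?_, ?_⟩
    · change Submodule.span K (g '' N) = ⊤
      rw [hspanK, hNspan, Submodule.map_top, LinearEquiv.range]
    · rw [← himage]
      exact Set.image_mono hNN'
    · rintro _ ⟨x, hx, rfl⟩
      exact (hmapM x (hNN' hx)).2 (hNM hx)
    · change Submodule.span _ (g '' N) = _
      rw [hspanA, hNA, hgA]
  · exact (Submodule.map_injective_of_injective
      (f := (g : (Fin d → K) →ₗ[K] (Fin d → K)).restrictScalars R) g.injective).injOn
  · rintro L ⟨hLFG, hLspan, hLP, hLM, hLA⟩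
    let N : Submodule R (Fin d → K) := L.map (g.symm.toLinearMap.restrictScalars R)
    have hgN : g '' (N : Set (Fin d → K)) = L := by
      change g '' (g.symm '' L) = L
      simp [Set.image_image]
    have hNN' : (N : Set (Fin d → K)) ⊆ N' := by
      rw [← Set.image_subset_image_iff g.injective, hgN, himage]
      exact hLP
    refine ⟨N, ⟨hLFG.map _, ?_, hNN', fun x hx => ?_, ?_⟩, SetLike.coe_injective hgN⟩
    · refine Submodule.map_injective_of_injective g.injective ?_
      rw [← hspanK, hgN, hLspan, Submodule.map_top, LinearEquiv.range]
    · exact (hmapM x (hNN' hx)).1 (hLM (hgN ▸ Set.mem_image_of_mem g hx))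
    · refine Submodule.map_injective_of_injective (f := gA) g.injective ?_
      rw [← hspanA, hgN, hLA, hgA]
end

section
/- Let R̃ ≅ k[[T]] be a complete DVR over a field k and let M̲ ⊆ L̃ be two R̃-lattices of rank d in K^d, with r the minimal number of generators of L̃/M̲. Then there is a direct sum decomposition L̃ = L^in ⊕ L^out with L^in ≅ R̃^{d−r}, L^out ≅ R̃^r, such that for any R̃-sublattice Ñ ⊆ L̃: Ñ + M̲ = L̃ if and only if Ñ + L^in = L̃. Consequently the set {Ñ ⊆ L̃ : Ñ + M̲ = L̃} is in bijection with pairs (Ñ', φ) with Ñ' an R̃-submodule of R̃^{d−r} of finite colength and φ ∈ Hom_{R̃}(R̃^r, R̃^{d−r}/Ñ'); under this bijection, dim_k(L̃/Ñ) = dim_k(R̃^{d−r}/Ñ'). -/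
theorem Submodule.sup_eq_iff_of_le_sup_maximalIdeal_smul {R V : Type*} [CommRing R] [IsLocalRing R]
    [AddCommGroup V] [Module R V] {A P L : Submodule R V} (hL : L.FG) (hAP : A ≤ P)
    (hPA : P ≤ A ⊔ IsLocalRing.maximalIdeal R • L) (hPL : P ≤ L) {N : Submodule R V}
    (hN : N ≤ L) : N ⊔ P = L ↔ N ⊔ A = L := by
  refine ⟨fun h => le_antisymm (sup_le hN (hAP.trans hPL)) ?_, fun h =>
    le_antisymm (sup_le hN hPL) (h.ge.trans (sup_le_sup_left hAP N))⟩
  refine le_of_le_smul_of_le_jacobson_bot hL (IsLocalRing.maximalIdeal_le_jacobson ⊥) ?_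
  calc L = N ⊔ P := h.symm
    _ ≤ N ⊔ (A ⊔ IsLocalRing.maximalIdeal R • L) := sup_le_sup_left hPA N
    _ = _ := sup_assoc _ _ _ |>.symm

theorem Module.Basis.exists_sum_basis_le_sup_maximalIdeal_smul {R M : Type*} [CommRing R]
    [IsDomain R] [IsPrincipalIdealRing R] [IsLocalRing R] [AddCommGroup M] [Module R M] {d r : ℕ}
    (b₀ : Module.Basis (Fin d) R M) (P : Submodule R M)
    (h₁ : ∃ s : Finset M, s.card = r ∧ P ⊔ Submodule.span R ↑s = ⊤)
    (h₂ : ∀ s : Finset M, P ⊔ Submodule.span R ↑s = ⊤ → r ≤ s.card) :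
    ∃ b : Module.Basis (Fin (d - r) ⊕ Fin r) R M, (∀ i, b (Sum.inl i) ∈ P) ∧
      P ≤ Submodule.span R (Set.range (b ∘ Sum.inl)) ⊔ IsLocalRing.maximalIdeal R • ⊤ := by
  classical
  obtain ⟨n, ⟨c, cP, f, a, snf⟩⟩ := P.smithNormalForm b₀
  have hfg : (⊤ : Submodule R M).FG := (Module.Finite.of_basis b₀).fg_top
  set A := Submodule.span R (c '' {i | c i ∈ P}) with hA
  have hAP : A ≤ P := Submodule.span_le.2 (by rintro _ ⟨i, hi, rfl⟩; exact hi)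
  have hPA : P ≤ A ⊔ IsLocalRing.maximalIdeal R • ⊤ := by
    have hP : P = Submodule.span R (Set.range fun j => (cP j : M)) := by
      have := congrArg (Submodule.map P.subtype) cP.span_eq
      rw [Submodule.map_span, Submodule.map_top, Submodule.range_subtype, ← Set.range_comp] at this
      exact this.symm
    refine hP.le.trans (Submodule.span_le.2 ?_)
    rintro _ ⟨j, rfl⟩
    by_cases hj : IsUnit (a j)
    · refine Submodule.mem_sup_left ?_
      have : c (f j) ∈ P := by
        rw [← Submodule.smul_mem_iff_of_isUnit P hj, ← snf]
        exact (cP j).2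
      simp only [snf]
      exact A.smul_mem _ (Submodule.subset_span ⟨_, this, rfl⟩)
    · refine Submodule.mem_sup_right ?_
      simp only [snf]
      exact Submodule.smul_mem_smul hj trivial
  have hle : r ≤ Fintype.card {i // ¬ c i ∈ P} := by
    have := h₂ ((Finset.univ.filter fun i => ¬ c i ∈ P).image c) (by
      rw [eq_top_iff, ← c.span_eq, Submodule.span_le]
      rintro _ ⟨i, rfl⟩
      by_cases hi : c i ∈ P
      · exact Submodule.mem_sup_left hi
      · exact Submodule.mem_sup_right (Submodule.subset_span (by simp; exact ⟨i, hi, rfl⟩)))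
    refine this.trans (Finset.card_image_le.trans ?_)
    rw [Fintype.card_subtype]
  have hge : d ≤ Fintype.card {i // c i ∈ P} + r := by
    obtain ⟨s, hs, hsP⟩ := h₁
    have htop : Submodule.span R ↑s ⊔ A = ⊤ :=
      (Submodule.sup_eq_iff_of_le_sup_maximalIdeal_smul hfg hAP hPA le_top le_top).1
        (by rwa [sup_comm])
    set t := s ∪ (Finset.univ.filter fun i => c i ∈ P).image c with ht
    have htt : Submodule.span R (t : Set M) = ⊤ := by
      rw [← htop, ht, hA]
      simp [Submodule.span_union]
    have := finrank_span_finset_le_card (R := R) t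
    rw [Set.finrank, htt, finrank_top, Module.finrank_eq_card_basis b₀, Fintype.card_fin] at this
    refine this.trans ((Finset.card_union_le _ _).trans ?_)
    rw [Fintype.card_subtype, hs, add_comm]
    exact Nat.add_le_add_right Finset.card_image_le _
  have hsum := Fintype.card_subtype_compl (fun i => c i ∈ P)
  have hle' := Fintype.card_subtype_le (fun i => c i ∈ P)
  rw [Fintype.card_fin] at hsum hle'
  let e₁ : {i // c i ∈ P} ≃ Fin (d - r) := Fintype.equivFinOfCardEq (by omega)
  let e₂ : {i // ¬ c i ∈ P} ≃ Fin r := Fintype.equivFinOfCardEq (by omega)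
  let e : Fin d ≃ Fin (d - r) ⊕ Fin r :=
    (Equiv.sumCompl fun i => c i ∈ P).symm.trans (Equiv.sumCongr e₁ e₂)
  have key : ∀ i, c (e.symm (Sum.inl i)) ∈ P := fun i => by
    simp only [e, Equiv.symm_trans_apply, Equiv.symm_symm, Equiv.sumCongr_symm,
      Equiv.sumCongr_apply, Sum.map_inl, Equiv.sumCompl_apply_inl]
    exact (e₁.symm i).2
  refine ⟨c.reindex e, fun i => by simpa using key i, hPA.trans (sup_le_sup_right ?_ _)⟩
  refine Submodule.span_mono ?_
  rintro _ ⟨i, hi, rfl⟩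
  refine ⟨e₁ ⟨i, hi⟩, ?_⟩
  simp [e]

theorem PowerSeries.finite_of_forall_X_pow_smul_eq_zero (k : Type*) [Field k] {M : Type*}
    [AddCommGroup M] [Module k M] [Module (PowerSeries k) M] [IsScalarTower k (PowerSeries k) M]
    [Module.Finite (PowerSeries k) M]
    (h : ∀ x : M, ∃ n : ℕ, (X : PowerSeries k) ^ n • x = 0) : Module.Finite k M := by
  classical
  choose n hn using h
  obtain ⟨s, hs⟩ := Module.Finite.fg_top (R := PowerSeries k) (M := M)
  refine ⟨s.biUnion fun x => (Finset.range (n x)).image fun i => (X : PowerSeries k) ^ i • x,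
    eq_top_iff.2 fun m _ => ?_⟩
  obtain ⟨g, -, rfl⟩ := Submodule.mem_span_finset.1 (hs ▸ Submodule.mem_top : m ∈ _)
  refine Submodule.sum_mem _ fun x hx => ?_
  have : g x • x = ∑ i ∈ Finset.range (n x), coeff i (g x) • (X : PowerSeries k) ^ i • x := by
    conv_lhs => rw [eq_X_pow_mul_shift_add_trunc (n x) (g x), add_smul, mul_comm, mul_smul, hn,
      smul_zero, zero_add]
    rw [trunc_apply, ← Finset.range_eq_Ico, ← Polynomial.coeToPowerSeries.ringHom_apply, map_sum,
      Finset.sum_smul]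
    refine Finset.sum_congr rfl fun i _ => ?_
    rw [Polynomial.coeToPowerSeries.ringHom_apply, Polynomial.coe_monomial, ← smul_assoc]
    congr 1
    rw [X_pow_eq, ← map_smul, smul_eq_mul, mul_one]
  rw [this]
  refine Submodule.sum_mem _ fun i hi => Submodule.smul_mem _ _ (Submodule.subset_span ?_)
  simp only [Finset.coe_biUnion, Set.mem_iUnion]
  exact ⟨x, hx, by simpa using ⟨i, by simpa using hi, rfl⟩⟩

theorem PowerSeries.exists_smul_eq_zero_of_finite (k : Type*) [Field k] {M : Type*}
    [AddCommGroup M] [Module k M] [Module (PowerSeries k) M] [IsScalarTower k (PowerSeries k) M]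
    [Module.Finite k M] (x : M) : ∃ c : PowerSeries k, c ≠ 0 ∧ c • x = 0 := by
  by_contra! h
  have hinj : Function.Injective
      ((LinearMap.toSpanSingleton (PowerSeries k) M x).restrictScalars k) := by
    rw [← LinearMap.ker_eq_bot, LinearMap.ker_eq_bot']
    intro c hc
    by_contra h0
    exact h c h0 hc
  have : Module.Finite k (PowerSeries k) := Module.Finite.of_injective _ hinj
  exact PowerSeries.not_isField (A := k)
    ((Algebra.IsIntegral.isField_iff_isField (algebraMap k (PowerSeries k)).injective).1
      (Field.toIsField k))

theorem PowerSeries.exists_X_pow_smul_eq_zero {k : Type*} [Field k] {M : Type*}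
    [AddCommGroup M] [Module (PowerSeries k) M] {x : M} {c : PowerSeries k} (hc : c ≠ 0)
    (h : c • x = 0) : ∃ n : ℕ, (X : PowerSeries k) ^ n • x = 0 := by
  obtain ⟨n, u, hu⟩ := IsDiscreteValuationRing.associated_pow_irreducible hc X_prime.irreducible
  exact ⟨n, by rw [← hu, mul_comm, mul_smul, h, smul_zero]⟩

theorem Submodule.exists_smul_mem_of_span_eq_top {R K V : Type*} [CommRing R] [IsDomain R] [Field K]
    [Algebra R K] [IsFractionRing R K] [AddCommGroup V] [Module R V] [Module K V]
    [IsScalarTower R K V] {N : Submodule R V} (h : Submodule.span K (N : Set V) = ⊤) (x : V) :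
    ∃ c : R, c ≠ 0 ∧ c • x ∈ N := by
  have hx : x ∈ Submodule.span K (N : Set V) := h ▸ Submodule.mem_top
  induction hx using Submodule.span_induction with
  | mem x hx => exact ⟨1, one_ne_zero, by simpa using hx⟩
  | zero => exact ⟨1, one_ne_zero, by simp⟩
  | add x y _ _ hx hy =>
    obtain ⟨c, hc, hcx⟩ := hx
    obtain ⟨c', hc', hcy⟩ := hy
    refine ⟨c * c', mul_ne_zero hc hc', ?_⟩
    rw [smul_add]
    refine N.add_mem ?_ ?_
    · rw [mul_comm, mul_smul]
      exact N.smul_mem _ hcx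
    · rw [mul_smul]
      exact N.smul_mem _ hcy
  | smul a x _ hx =>
    obtain ⟨c, hc, hcx⟩ := hx
    obtain ⟨p, q, hq, rfl⟩ := IsFractionRing.div_surjective (A := R) a
    have hq0 : q ≠ 0 := nonZeroDivisors.ne_zero hq
    refine ⟨q * c, mul_ne_zero hq0 hc, ?_⟩
    have : (q * c) • (algebraMap R K p / algebraMap R K q) • x = p • c • x := by
      have hq' : algebraMap R K q ≠ 0 := by simpa using hq0
      rw [← algebraMap_smul K (q * c), ← algebraMap_smul K p, ← algebraMap_smul K c, smul_smul,
        smul_smul]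
      congr 1
      rw [map_mul]
      field_simp
    rw [this]
    exact N.smul_mem _ hcx

theorem Submodule.span_eq_top_of_exists_smul_mem {R K V : Type*} [CommRing R] [IsDomain R] [Field K]
    [Algebra R K] [IsFractionRing R K] [AddCommGroup V] [Module R V] [Module K V]
    [IsScalarTower R K V] {L N : Submodule R V} (hL : Submodule.span K (L : Set V) = ⊤)
    (h : ∀ x ∈ L, ∃ c : R, c ≠ 0 ∧ c • x ∈ N) : Submodule.span K (N : Set V) = ⊤ := by
  rw [eq_top_iff, ← hL, Submodule.span_le]
  intro x hx
  obtain ⟨c, hc, hcx⟩ := h x hx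
  have hc' : algebraMap R K c ≠ 0 := by simpa using hc
  have := Submodule.smul_mem (Submodule.span K (N : Set V)) (algebraMap R K c)⁻¹
    (Submodule.subset_span hcx)
  rwa [← algebraMap_smul K c x, inv_smul_smul₀ hc'] at this

section
variable {R A B : Type*} [CommRing R] [AddCommGroup A] [Module R A] [AddCommGroup B] [Module R B]

theorem LinearMap.coprod_mkQ_surjective (N' : Submodule R A) (φ : B →ₗ[R] A ⧸ N') :
    Function.Surjective (N'.mkQ.coprod φ) := fun y => by
  obtain ⟨a, rfl⟩ := N'.mkQ_surjective y
  exact ⟨(a, 0), by simp⟩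

theorem LinearMap.ker_coprod_mkQ_sup_range_inl (N' : Submodule R A) (φ : B →ₗ[R] A ⧸ N') :
    LinearMap.ker (N'.mkQ.coprod φ) ⊔ LinearMap.range (LinearMap.inl R A B) = ⊤ := by
  rw [eq_top_iff]
  rintro ⟨a, b⟩ -
  obtain ⟨c, hc⟩ := N'.mkQ_surjective (φ b)
  refine Submodule.mem_sup.2 ⟨(-c, b), ?_, (a + c, 0), ⟨a + c, rfl⟩, by simp⟩
  rw [LinearMap.mem_ker, LinearMap.coprod_apply, map_neg, hc, neg_add_cancel]

theorem LinearMap.ker_coprod_mkQ_injective : Function.Injective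
    fun q : Σ N' : Submodule R A, B →ₗ[R] A ⧸ N' => LinearMap.ker (q.1.mkQ.coprod q.2) := by
  rintro ⟨N₁, φ₁⟩ ⟨N₂, φ₂⟩ h
  replace h : LinearMap.ker (N₁.mkQ.coprod φ₁) = LinearMap.ker (N₂.mkQ.coprod φ₂) := h
  obtain rfl : N₁ = N₂ := by
    ext a
    have := SetLike.ext_iff.1 h (a, 0)
    simpa using this
  congr 1
  ext b
  obtain ⟨c, hc⟩ := N₁.mkQ_surjective (φ₁ b)
  have h₁ : (-c, b) ∈ LinearMap.ker (N₁.mkQ.coprod φ₁) := by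
    rw [LinearMap.mem_ker, LinearMap.coprod_apply, map_neg, hc, neg_add_cancel]
  rw [h, LinearMap.mem_ker, LinearMap.coprod_apply, map_neg, hc, neg_add_eq_zero] at h₁
  exact h₁

theorem LinearMap.exists_ker_coprod_mkQ_eq {N : Submodule R (A × B)}
    (hN : N ⊔ LinearMap.range (LinearMap.inl R A B) = ⊤) :
    ∃ (N' : Submodule R A) (φ : B →ₗ[R] A ⧸ N'), LinearMap.ker (N'.mkQ.coprod φ) = N := by
  let f : A →ₗ[R] (A × B) ⧸ N := N.mkQ ∘ₗ LinearMap.inl R A B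
  have hf : Function.Surjective f := by
    rw [← LinearMap.range_eq_top, LinearMap.range_comp, ← top_le_iff, ← N.range_mkQ,
      ← Submodule.map_top, ← hN, Submodule.map_sup]
    simp
  let e := f.quotKerEquivOfSurjective hf
  refine ⟨LinearMap.ker f, e.symm.toLinearMap ∘ₗ N.mkQ ∘ₗ LinearMap.inr R A B, ?_⟩
  have he : ∀ a, e ((LinearMap.ker f).mkQ a) = N.mkQ (a, 0) := fun _ => rfl
  ext ⟨a, b⟩
  rw [LinearMap.mem_ker, ← e.map_eq_zero_iff, LinearMap.coprod_apply, map_add, he]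
  simp [← Submodule.Quotient.mk_add]

variable {V : Type*} [AddCommGroup V] [Module R V]

/-- Given a predicate `p` on submodules of `V` and a predicate `p'` on submodules of `A` that agree
under the correspondence, submodules of `j (A × B)` satisfying `p`, all of which together with
`j (A × 0)` span `j (A × B)`, correspond to pairs of a submodule `N'` of `A` satisfying `p'` and a
map `B → A ⧸ N'`. -/
noncomputable def LinearMap.sigmaEquivSubmoduleSupEq (j : A × B →ₗ[R] V)
    (hj : Function.Injective j) (p : Submodule R V → Prop) (p' : Submodule R A → Prop)
    (hp : ∀ N, p N → N ≤ LinearMap.range j ∧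
      N ⊔ LinearMap.range (j ∘ₗ LinearMap.inl R A B) = LinearMap.range j)
    (hpp' : ∀ (N' : Submodule R A) (φ : B →ₗ[R] A ⧸ N'),
      p ((LinearMap.ker (N'.mkQ.coprod φ)).map j) ↔ p' N') :
    (Σ N' : {N' : Submodule R A // p' N'}, B →ₗ[R] A ⧸ (N' : Submodule R A)) ≃
      {N : Submodule R V // p N} :=
  Equiv.ofBijective
    (fun q => ⟨(LinearMap.ker (q.1.1.mkQ.coprod q.2)).map j, (hpp' _ _).2 q.1.2⟩) (by
    constructor
    · rintro ⟨⟨N₁, h₁⟩, φ₁⟩ ⟨⟨N₂, h₂⟩, φ₂⟩ h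
      have h := LinearMap.ker_coprod_mkQ_injective (a₁ := ⟨N₁, φ₁⟩) (a₂ := ⟨N₂, φ₂⟩)
        (Submodule.map_injective_of_injective hj (congrArg Subtype.val h))
      cases h
      rfl
    · rintro ⟨N, hN⟩
      obtain ⟨hle, hsup⟩ := hp N hN
      have hmap : (N.comap j).map j = N := Submodule.map_comap_eq_of_le hle
      have htop : N.comap j ⊔ LinearMap.range (LinearMap.inl R A B) = ⊤ := by
        apply Submodule.map_injective_of_injective hj
        rw [Submodule.map_sup, hmap, Submodule.map_top, ← hsup, LinearMap.range_comp]
      obtain ⟨N', φ, h⟩ := LinearMap.exists_ker_coprod_mkQ_eq htop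
      rw [← h] at hmap
      exact ⟨⟨⟨N', (hpp' N' φ).1 (hmap ▸ hN)⟩, φ⟩, Subtype.ext hmap⟩)

end

/-- Let `R̃ = k⟦T⟧` with fraction field `K = k((T))`, and let
`M̲ ⊆ L̃` be two `R̃`-lattices of rank `d` in `K^d`, with `r` the minimal number of
generators of `L̃/M̲`.  Then there is a direct sum decomposition `L̃ = Lin ⊕ Lout`
with `Lin ≅ R̃^{d-r}`, `Lout ≅ R̃^r`, such that for any `R̃`-sublattice `Ñ ⊆ L̃`:
`Ñ + M̲ = L̃ ↔ Ñ + Lin = L̃`.  Consequently `{Ñ ⊆ L̃ : Ñ + M̲ = L̃}` is in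
bijection with pairs `(Ñ', φ)` where `Ñ' ⊆ R̃^{d-r}` is a submodule of finite
colength and `φ : R̃^r →ₗ R̃^{d-r}/Ñ'`; under this bijection
`dim_k (L̃/Ñ) = dim_k (R̃^{d-r}/Ñ')`. -/
theorem statement5 (k : Type*) [Field k] (K : Type*) [Field K]
    [Algebra (PowerSeries k) K] [IsFractionRing (PowerSeries k) K]
    [Algebra k K] [IsScalarTower k (PowerSeries k) K]
    (d : ℕ)
    (Mu Lt : Submodule (PowerSeries k) (Fin d → K))
    (hMuFG : Mu.FG) (hMuspan : Submodule.span K (Mu : Set (Fin d → K)) = ⊤)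
    (hLtFG : Lt.FG) (hLtspan : Submodule.span K (Lt : Set (Fin d → K)) = ⊤)
    (hML : Mu ≤ Lt)
    -- `r` is the minimal number of generators of `L̃/M̲`
    (r : ℕ) (hrd : r ≤ d)
    (hr₁ : ∃ s : Finset (Fin d → K), s.card = r ∧
      ↑s ⊆ (Lt : Set (Fin d → K)) ∧ Mu ⊔ Submodule.span (PowerSeries k) ↑s = Lt)
    (hr₂ : ∀ s : Finset (Fin d → K),
      ↑s ⊆ (Lt : Set (Fin d → K)) → Mu ⊔ Submodule.span (PowerSeries k) ↑s = Lt →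
      r ≤ s.card) :
    ∃ Lin Lout : Submodule (PowerSeries k) (Fin d → K),
      Lin ⊔ Lout = Lt ∧ Lin ⊓ Lout = ⊥ ∧
      Nonempty (Lin ≃ₗ[PowerSeries k] (Fin (d - r) → PowerSeries k)) ∧
      Nonempty (Lout ≃ₗ[PowerSeries k] (Fin r → PowerSeries k)) ∧
      (∀ N : Submodule (PowerSeries k) (Fin d → K), N ≤ Lt →
        (N ⊔ Mu = Lt ↔ N ⊔ Lin = Lt)) ∧
      ∃ e : {N : Submodule (PowerSeries k) (Fin d → K) //
              N.FG ∧ Submodule.span K (N : Set (Fin d → K)) = ⊤ ∧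
              N ≤ Lt ∧ N ⊔ Mu = Lt} ≃
            (Σ N' : {p : Submodule (PowerSeries k) (Fin (d - r) → PowerSeries k) //
                Module.Finite k ((Fin (d - r) → PowerSeries k) ⧸ p.restrictScalars k)},
              ((Fin r → PowerSeries k) →ₗ[PowerSeries k]
                ((Fin (d - r) → PowerSeries k) ⧸
                  (N' : Submodule (PowerSeries k) (Fin (d - r) → PowerSeries k))))),
        ∀ N : {N : Submodule (PowerSeries k) (Fin d → K) //
              N.FG ∧ Submodule.span K (N : Set (Fin d → K)) = ⊤ ∧
              N ≤ Lt ∧ N ⊔ Mu = Lt},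
          Module.finrank k
              (Lt ⧸ Submodule.restrictScalars k
                ((N : Submodule (PowerSeries k) (Fin d → K)).comap Lt.subtype)) =
            Module.finrank k
              ((Fin (d - r) → PowerSeries k) ⧸ Submodule.restrictScalars k
                ((e N).1 : Submodule (PowerSeries k) (Fin (d - r) → PowerSeries k))) := by
  classical
  have : Submodule.IsLattice K Lt := ⟨hLtFG, hLtspan⟩
  have hfin : Module.Finite (PowerSeries k) Lt := Module.Finite.of_fg hLtFG
  have hfree : Module.Free (PowerSeries k) Lt := Submodule.IsLattice.free K Lt
  have hrank : Module.finrank (PowerSeries k) Lt = d := by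
    rw [Submodule.IsLattice.finrank_of_pi K Lt, Fintype.card_fin]
  obtain ⟨b, hbMu, hMub⟩ := (Module.finBasisOfFinrankEq _ _ hrank
    ).exists_sum_basis_le_sup_maximalIdeal_smul (r := r) (Mu.comap Lt.subtype) (by
      obtain ⟨s, hs, hsL, hsup⟩ := hr₁
      refine ⟨s.subtype (· ∈ Lt), ?_, ?_⟩
      · rw [Finset.card_subtype, Finset.filter_true_of_mem (p := (· ∈ Lt)) fun x hx => hsL hx, hs]
      · apply Submodule.map_injective_of_injective Lt.subtype_injective
        rw [Submodule.map_sup, Submodule.map_comap_subtype, inf_eq_right.2 hML, Submodule.map_span,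
          Submodule.map_top, Submodule.range_subtype]
        refine Eq.trans ?_ hsup
        congr 2
        ext x
        simpa using fun hx => hsL hx) (by
      intro s hs
      rw [← Finset.card_map (Function.Embedding.subtype (· ∈ Lt))]
      refine hr₂ _ (by intro x hx; simp at hx; exact hx.1) ?_
      replace hs := congrArg (Submodule.map Lt.subtype) hs
      rw [Submodule.map_sup, Submodule.map_comap_subtype, inf_eq_right.2 hML, Submodule.map_span,
          Submodule.map_top, Submodule.range_subtype] at hs
      rw [Finset.coe_map]
      exact hs)
  let E : ((Fin (d - r) → PowerSeries k) × (Fin r → PowerSeries k)) ≃ₗ[PowerSeries k] Lt :=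
    (LinearEquiv.sumArrowLequivProdArrow _ _ _ _).symm.trans b.equivFun.symm
  let j : (Fin (d - r) → PowerSeries k) × (Fin r → PowerSeries k) →ₗ[PowerSeries k] (Fin d → K) :=
    Lt.subtype ∘ₗ E.toLinearMap
  have hj : Function.Injective j := Lt.subtype_injective.comp E.injective
  have hjr : LinearMap.range j = Lt := by simp [j, LinearMap.range_comp]
  have hEinl : LinearMap.range (E.toLinearMap ∘ₗ LinearMap.inl _ _ _) =
      Submodule.span (PowerSeries k) (Set.range (b ∘ Sum.inl)) := by
    rw [← Fintype.range_linearCombination]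
    congr 1
    refine LinearMap.ext fun x => ?_
    simp [E, Module.Basis.equivFun_symm_apply, Fintype.linearCombination_apply]
  set Lin := LinearMap.range (j ∘ₗ LinearMap.inl _ _ _) with hLin
  set Lout := LinearMap.range (j ∘ₗ LinearMap.inr _ _ _) with hLout
  have hLin' : Lin = (Submodule.span (PowerSeries k) (Set.range (b ∘ Sum.inl))).map Lt.subtype := by
    rw [← hEinl, ← LinearMap.range_comp]
    rfl
  have hLinMu : Lin ≤ Mu := by
    rw [hLin', Submodule.map_le_iff_le_comap, Submodule.span_le]
    rintro _ ⟨i, rfl⟩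
    exact hbMu i
  have hMuLin : Mu ≤ Lin ⊔ IsLocalRing.maximalIdeal (PowerSeries k) • Lt := by
    have := Submodule.map_mono (f := Lt.subtype) hMub
    rwa [Submodule.map_sup, Submodule.map_comap_subtype, inf_eq_right.2 hML, Submodule.map_smul'',
      Submodule.map_top, Submodule.range_subtype, ← hLin'] at this
  have hiff : ∀ N : Submodule (PowerSeries k) (Fin d → K), N ≤ Lt →
      (N ⊔ Mu = Lt ↔ N ⊔ Lin = Lt) := fun N hN =>
    Submodule.sup_eq_iff_of_le_sup_maximalIdeal_smul hLtFG hLinMu hMuLin hML hN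
  have hinl : Function.Injective (j ∘ₗ LinearMap.inl _ _ _) := hj.comp LinearMap.inl_injective
  have hinr : Function.Injective (j ∘ₗ LinearMap.inr _ _ _) := hj.comp LinearMap.inr_injective
  refine ⟨Lin, Lout, ?_, ?_, ⟨(LinearEquiv.ofInjective _ hinl).symm⟩,
    ⟨(LinearEquiv.ofInjective _ hinr).symm⟩, hiff, ?_⟩
  · rw [hLin, hLout, LinearMap.range_comp, LinearMap.range_comp, ← Submodule.map_sup,
      LinearMap.sup_range_inl_inr, Submodule.map_top, hjr]
  · rw [hLin, hLout, LinearMap.range_comp, LinearMap.range_comp, ← Submodule.map_inf _ hj,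
      LinearMap.isCompl_range_inl_inr.inf_eq_bot, Submodule.map_bot]
  have hquot : ∀ (N' : Submodule (PowerSeries k) (Fin (d - r) → PowerSeries k))
      (φ : (Fin r → PowerSeries k) →ₗ[PowerSeries k] (Fin (d - r) → PowerSeries k) ⧸ N'),
      Nonempty ((Lt ⧸ ((LinearMap.ker (N'.mkQ.coprod φ)).map j).comap Lt.subtype) ≃ₗ[PowerSeries k]
        (Fin (d - r) → PowerSeries k) ⧸ N') := by
    intro N' φ
    have hker : ((LinearMap.ker (N'.mkQ.coprod φ)).map j).comap Lt.subtype =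
        LinearMap.ker (N'.mkQ.coprod φ ∘ₗ E.symm.toLinearMap) := by
      rw [Submodule.map_comp, Submodule.comap_map_eq_of_injective Lt.subtype_injective,
        LinearMap.ker_comp, ← Submodule.map_equiv_eq_comap_symm]
    rw [hker]
    exact ⟨LinearMap.quotKerEquivOfSurjective _
      ((LinearMap.coprod_mkQ_surjective N' φ).comp E.symm.surjective)⟩
  have hle : ∀ M : Submodule (PowerSeries k) _, M.map j ≤ Lt := fun M =>
    (LinearMap.map_le_range).trans hjr.le
  have hspan : ∀ (N' : Submodule (PowerSeries k) (Fin (d - r) → PowerSeries k))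
      (φ : (Fin r → PowerSeries k) →ₗ[PowerSeries k] (Fin (d - r) → PowerSeries k) ⧸ N'),
      Submodule.span K (((LinearMap.ker (N'.mkQ.coprod φ)).map j : Submodule (PowerSeries k) _) :
        Set (Fin d → K)) = ⊤ ↔
      Module.Finite k ((Fin (d - r) → PowerSeries k) ⧸ N'.restrictScalars k) := by
    intro N' φ
    obtain ⟨ε⟩ := hquot N' φ
    rw [Module.Finite.equiv_iff (Submodule.Quotient.restrictScalarsEquiv k N')]
    constructor
    · intro h
      have : Module.Finite k
          (Lt ⧸ ((LinearMap.ker (N'.mkQ.coprod φ)).map j).comap Lt.subtype) := by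
        refine PowerSeries.finite_of_forall_X_pow_smul_eq_zero k fun x => ?_
        obtain ⟨x, rfl⟩ := Submodule.mkQ_surjective _ x
        obtain ⟨c, hc, hcx⟩ := Submodule.exists_smul_mem_of_span_eq_top (R := PowerSeries k) h x
        refine PowerSeries.exists_X_pow_smul_eq_zero hc ?_
        rw [← map_smul]
        exact (Submodule.Quotient.mk_eq_zero _).2 hcx
      exact Module.Finite.equiv (ε.restrictScalars k)
    · intro h
      have : Module.Finite k
          (Lt ⧸ ((LinearMap.ker (N'.mkQ.coprod φ)).map j).comap Lt.subtype) :=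
        Module.Finite.equiv (ε.restrictScalars k).symm
      refine Submodule.span_eq_top_of_exists_smul_mem hLtspan fun x hx => ?_
      obtain ⟨c, hc, hcx⟩ := PowerSeries.exists_smul_eq_zero_of_finite k
        (Submodule.mkQ (((LinearMap.ker (N'.mkQ.coprod φ)).map j).comap Lt.subtype) ⟨x, hx⟩)
      rw [← map_smul, Submodule.mkQ_apply, Submodule.Quotient.mk_eq_zero] at hcx
      exact ⟨c, hc, hcx⟩
  let e := j.sigmaEquivSubmoduleSupEq hj
    (fun N => N.FG ∧ Submodule.span K (N : Set (Fin d → K)) = ⊤ ∧ N ≤ Lt ∧ N ⊔ Mu = Lt)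
    (fun p => Module.Finite k ((Fin (d - r) → PowerSeries k) ⧸ p.restrictScalars k))
    (fun N ⟨_, _, hN, hNMu⟩ => by
      rw [hjr]
      exact ⟨hN, (hiff N hN).1 hNMu⟩)
    (fun N' φ => by
      rw [← hspan N' φ]
      refine ⟨fun h => h.2.1, fun h => ⟨(IsNoetherian.noetherian _).map j, h, hle _, ?_⟩⟩
      rw [hiff _ (hle _), hLin, LinearMap.range_comp, ← Submodule.map_sup,
        LinearMap.ker_coprod_mkQ_sup_range_inl, Submodule.map_top, hjr])
  refine ⟨e.symm, fun N => ?_⟩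
  obtain ⟨q, rfl⟩ := e.surjective N
  rw [e.symm_apply_apply]
  obtain ⟨ε⟩ := hquot q.1.1 q.2
  exact ((Submodule.Quotient.restrictScalarsEquiv k _).trans
    ((ε.restrictScalars k).trans (Submodule.Quotient.restrictScalarsEquiv k _).symm)).finrank_eq
end
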